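/- (Corollary 3.) Let p ≥ 2 be an integer, α > 0, Σ ∈ ℝ^{p×p} symmetric positive definite, A > 0, k₂ = Γ((α+p)/2)/(Γ(α/2)(απ)^{p/2}√(det Σ)), c_α = Γ((α+1)/2)/(Γ(α/2)√(απ)), and let h(n) = k₂·(1 + nᵀΣ⁻¹n/α)^{−(α+p)/2} be the pure bursty impulsive-noise density (GS model with ρ = 0). Then the exact error probability of ML demodulation of BPSK satisfies ∫_{{n : h(n + 2A·e_p) > h(n)}} h(n) dn = 1/2 − c_α·∫₀^{A√(e_pᵀΣ⁻¹e_p)} (1 + t²/α)^{−(α+1)/2} dt. -/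

import Mathlib

open Matrix Real MeasureTheory

theorem lintegral_rpow_mul_exp_neg_mul_Ioi {s c : ℝ} (hs : 0 < s) (hc : 0 < c) :
    ∫⁻ u in Set.Ioi (0 : ℝ), ENNReal.ofReal (u ^ (s - 1) * exp (-(c * u))) =
      ENNReal.ofReal (Gamma s * c ^ (-s)) := by
  have hval := integral_rpow_mul_exp_neg_mul_Ioi hs hc
  have hΓ := Gamma_pos_of_pos hs
  have hint : IntegrableOn (fun u : ℝ => u ^ (s - 1) * exp (-(c * u))) (Set.Ioi 0) := by
    by_contra hcon
    rw [integral_undef hcon] at hval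
    have : 0 < (1 / c) ^ s * Gamma s := by positivity
    exact this.ne hval
  rw [← ofReal_integral_eq_lintegral_ofReal hint
    ((ae_restrict_iff' measurableSet_Ioi).2 (.of_forall fun u (hu : 0 < u) => by positivity)),
    hval, one_div, inv_rpow hc.le, rpow_neg hc.le, mul_comm]

theorem lintegral_exp_neg_mul_sum_sq_slab {ι : Type*} [Fintype ι] [DecidableEq ι] (i₀ : ι)
    {T : Set ℝ} (hT : MeasurableSet T) {b : ℝ} (hb : 0 < b) :
    ∫⁻ y in {y : ι → ℝ | y i₀ ∈ T}, ENNReal.ofReal (exp (-(b * ∑ i, y i ^ 2))) =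
      ENNReal.ofReal (√(π / b) ^ (Fintype.card ι - 1)) *
        ∫⁻ t in T, ENNReal.ofReal (exp (-(b * t ^ 2))) := by
  have hg : Integrable fun t : ℝ => exp (-(b * t ^ 2)) := by
    simpa only [neg_mul] using integrable_exp_neg_mul_sq hb
  have hgval : ∫ t : ℝ, exp (-(b * t ^ 2)) = √(π / b) := by
    simpa only [neg_mul] using integral_gaussian b
  let f : ι → ℝ → ℝ := fun i =>
    if i = i₀ then T.indicator fun t => exp (-(b * t ^ 2)) else fun t => exp (-(b * t ^ 2))
  have hf : ∀ i, Integrable (f i) := fun i => by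
    by_cases hi : i = i₀
    · simpa only [f, if_pos hi] using hg.indicator hT
    · simpa only [f, if_neg hi] using hg
  have hS : MeasurableSet {y : ι → ℝ | y i₀ ∈ T} := measurable_pi_apply i₀ hT
  have hprod : (fun y : ι → ℝ => ∏ i, f i (y i)) =
      {y : ι → ℝ | y i₀ ∈ T}.indicator fun y => exp (-(b * ∑ i, y i ^ 2)) := by
    ext y
    have hexp : exp (-(b * ∑ i, y i ^ 2)) = ∏ i, exp (-(b * y i ^ 2)) := by
      rw [← exp_sum, Finset.mul_sum, Finset.sum_neg_distrib]
    by_cases hy : y i₀ ∈ T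
    · rw [Set.indicator_of_mem (by exact hy), hexp]
      refine Finset.prod_congr rfl fun i _ => ?_
      by_cases hi : i = i₀
      · subst hi; simp [f, hy]
      · simp [f, hi]
    · rw [Set.indicator_of_notMem (by exact hy)]
      exact Finset.prod_eq_zero (Finset.mem_univ i₀) (by simp [f, hy])
  have hint := Integrable.fintype_prod (μ := fun _ : ι => (volume : Measure ℝ)) hf
  have hval := integral_fintype_prod_volume_eq_prod f
  rw [← Finset.mul_prod_erase _ _ (Finset.mem_univ i₀)] at hval
  rw [Finset.prod_congr rfl (g := fun _ => √(π / b)) fun i hi => by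
    simp only [f, if_neg (Finset.ne_of_mem_erase hi), hgval]] at hval
  rw [Finset.prod_const, Finset.card_erase_of_mem (Finset.mem_univ i₀), Finset.card_univ] at hval
  simp only [f, if_true] at hval
  rw [← volume_pi] at hint
  change ∫ y : ι → ℝ, (fun y : ι → ℝ => ∏ i, f i (y i)) y = _ at hval
  rw [hprod, integral_indicator hS, integral_indicator hT] at hval
  rw [hprod, integrable_indicator_iff hS] at hint
  rw [← ofReal_integral_eq_lintegral_ofReal hint (.of_forall fun _ => (exp_pos _).le),
    ← ofReal_integral_eq_lintegral_ofReal hg.integrableOn (.of_forall fun _ => (exp_pos _).le),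
    hval, mul_comm, ENNReal.ofReal_mul (by positivity)]

theorem Gamma_mul_lintegral_one_add_div_rpow {X : Type*} [MeasurableSpace X] (μ : Measure X)
    [SFinite μ] {q : X → ℝ} (hq : Measurable q) (hq0 : ∀ x, 0 ≤ q x) {α s : ℝ} (hα : 0 < α)
    (hs : 0 < s) :
    ENNReal.ofReal (Gamma s) * ∫⁻ x, ENNReal.ofReal ((1 + q x / α) ^ (-s)) ∂μ =
      ∫⁻ u in Set.Ioi (0 : ℝ), ENNReal.ofReal (u ^ (s - 1) * exp (-u)) *
        ∫⁻ x, ENNReal.ofReal (exp (-(u / α * q x))) ∂μ := by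
  have hmix : ∀ x, ENNReal.ofReal (Gamma s) * ENNReal.ofReal ((1 + q x / α) ^ (-s)) =
      ∫⁻ u in Set.Ioi (0 : ℝ), ENNReal.ofReal (u ^ (s - 1) * exp (-u)) *
        ENNReal.ofReal (exp (-(u / α * q x))) := fun x => by
    have := hq0 x
    rw [← ENNReal.ofReal_mul (Gamma_pos_of_pos hs).le,
      ← lintegral_rpow_mul_exp_neg_mul_Ioi hs (by positivity)]
    refine setLIntegral_congr_fun measurableSet_Ioi fun u (hu : 0 < u) => ?_
    rw [← ENNReal.ofReal_mul (by positivity), mul_assoc, ← exp_add]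
    congr 3
    ring
  rw [← lintegral_const_mul _ (by fun_prop), lintegral_congr hmix,
    lintegral_lintegral_swap (by fun_prop)]
  exact lintegral_congr fun u => lintegral_const_mul _ (by fun_prop)

theorem sqrt_pi_div_div {α u : ℝ} (hα : 0 < α) (hu : 0 < u) :
    √(π / (u / α)) = √(α * π) * u ^ (-(1 / 2) : ℝ) := by
  rw [show π / (u / α) = α * π / u by field_simp, sqrt_div (by positivity), rpow_neg hu.le,
    ← sqrt_eq_rpow, div_eq_mul_inv]

/-- Integrating out all coordinates but one of an unnormalized Student-t density. -/
theorem Gamma_mul_lintegral_slab {ι : Type*} [Fintype ι] [DecidableEq ι] (i₀ : ι)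
    {T : Set ℝ} (hT : MeasurableSet T) {α : ℝ} (hα : 0 < α) :
    ENNReal.ofReal (Gamma ((α + Fintype.card ι) / 2)) *
        ∫⁻ y in {y : ι → ℝ | y i₀ ∈ T},
          ENNReal.ofReal ((1 + (∑ i, y i ^ 2) / α) ^ (-(α + Fintype.card ι) / 2)) =
      ENNReal.ofReal (√(α * π) ^ (Fintype.card ι - 1)) * (ENNReal.ofReal (Gamma ((α + 1) / 2)) *
        ∫⁻ t in T, ENNReal.ofReal ((1 + t ^ 2 / α) ^ (-(α + 1) / 2))) := by
  have hcard : 1 ≤ Fintype.card ι := Fintype.card_pos_iff.2 ⟨i₀⟩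
  simp only [neg_div]
  rw [Gamma_mul_lintegral_one_add_div_rpow _ (by fun_prop)
      (fun y => Finset.sum_nonneg fun i _ => sq_nonneg _) hα (by positivity),
    Gamma_mul_lintegral_one_add_div_rpow _ (by fun_prop) (fun t => sq_nonneg t) hα (by positivity),
    ← lintegral_const_mul' _ _ ENNReal.ofReal_ne_top]
  refine setLIntegral_congr_fun measurableSet_Ioi fun u (hu : 0 < u) => ?_
  rw [lintegral_exp_neg_mul_sum_sq_slab i₀ hT (by positivity), ← mul_assoc, ← mul_assoc,
    ← ENNReal.ofReal_mul (by positivity), ← ENNReal.ofReal_mul (by positivity)]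
  congr 2
  have hu' : u ^ ((α + Fintype.card ι) / 2 - 1) * (u ^ (-(1 / 2) : ℝ)) ^ (Fintype.card ι - 1) =
      u ^ ((α + 1) / 2 - 1) := by
    rw [← rpow_natCast, ← rpow_mul hu.le, ← rpow_add hu, Nat.cast_sub hcard]
    congr 1
    push_cast
    ring
  rw [sqrt_pi_div_div hα hu, mul_pow, ← hu']
  ring

theorem lintegral_one_add_sq_div_rpow {α : ℝ} (hα : 0 < α) :
    ENNReal.ofReal (Gamma ((α + 1) / 2)) *
        ∫⁻ t : ℝ, ENNReal.ofReal ((1 + t ^ 2 / α) ^ (-(α + 1) / 2)) =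
      ENNReal.ofReal (√(α * π) * Gamma (α / 2)) := by
  have hΓ := lintegral_rpow_mul_exp_neg_mul_Ioi (half_pos hα) one_pos
  rw [one_rpow, mul_one] at hΓ
  simp only [neg_div]
  rw [Gamma_mul_lintegral_one_add_div_rpow _ (by fun_prop) (fun t => sq_nonneg t) hα
      (by positivity), ENNReal.ofReal_mul (by positivity), ← hΓ, ← lintegral_const_mul' _ _ ENNReal.ofReal_ne_top]
  refine setLIntegral_congr_fun measurableSet_Ioi fun u (hu : 0 < u) => ?_
  have hb : 0 < u / α := by positivity
  have hg : ∫⁻ t : ℝ, ENNReal.ofReal (exp (-(u / α * t ^ 2))) = ENNReal.ofReal √(π / (u / α)) := by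
    simp only [← neg_mul]
    rw [← integral_gaussian, ofReal_integral_eq_lintegral_ofReal (integrable_exp_neg_mul_sq hb)
      (.of_forall fun _ => (exp_pos _).le)]
  have hu' : u ^ ((α + 1) / 2 - 1) * u ^ (-(1 / 2) : ℝ) = u ^ (α / 2 - 1) := by
    rw [← rpow_add hu]
    congr 1
    ring
  rw [hg, ← ENNReal.ofReal_mul (by positivity), ← ENNReal.ofReal_mul (by positivity),
    sqrt_pi_div_div hα hu, ← hu', one_mul]
  congr 1
  ring

theorem integrable_one_add_sq_div_rpow {α : ℝ} (hα : 0 < α) :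
    Integrable fun t : ℝ => (1 + t ^ 2 / α) ^ (-(α + 1) / 2) := by
  have hΓ : 0 < Gamma ((α + 1) / 2) := Gamma_pos_of_pos (by positivity)
  refine (lintegral_ofReal_ne_top_iff_integrable (by fun_prop : Measurable _).aestronglyMeasurable
    (.of_forall fun t => by positivity)).1 fun htop => ?_
  have := lintegral_one_add_sq_div_rpow hα
  rw [htop, ENNReal.mul_top (by simpa using hΓ)] at this
  exact ENNReal.ofReal_ne_top this.symm

theorem integral_one_add_sq_div_rpow {α : ℝ} (hα : 0 < α) :
    Gamma ((α + 1) / 2) * ∫ t : ℝ, (1 + t ^ 2 / α) ^ (-(α + 1) / 2) =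
      √(α * π) * Gamma (α / 2) := by
  have hΓ : 0 < Gamma ((α + 1) / 2) := Gamma_pos_of_pos (by positivity)
  have hΓ' : 0 < Gamma (α / 2) := Gamma_pos_of_pos (by positivity)
  have hnn : ∀ t : ℝ, 0 ≤ (1 + t ^ 2 / α) ^ (-(α + 1) / 2) := fun t => by positivity
  have := lintegral_one_add_sq_div_rpow hα
  rw [← ofReal_integral_eq_lintegral_ofReal (integrable_one_add_sq_div_rpow hα) (.of_forall hnn),
    ← ENNReal.ofReal_mul hΓ.le] at this
  exact (ENNReal.ofReal_eq_ofReal_iff (mul_nonneg hΓ.le (integral_nonneg hnn))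
    (by positivity)).1 this

/-- The lower tail of an even integrable function. -/
theorem setIntegral_Iio_neg_eq {f : ℝ → ℝ} (hf : Integrable f) (heven : ∀ t, f (-t) = f t)
    (a : ℝ) : ∫ t in Set.Iio (-a), f t = (∫ t, f t) / 2 - ∫ t in (0 : ℝ)..a, f t := by
  have hneg : ∀ c, ∫ t in Set.Iic (-c), f t = ∫ t in Set.Ioi c, f t := fun c => by
    rw [← integral_comp_neg_Ioi]
    simp only [heven]
  have h0 := hneg 0
  rw [neg_zero] at h0
  have htot := intervalIntegral.integral_Iic_add_Ioi (b := (0 : ℝ)) hf.integrableOn hf.integrableOn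
  have hsub := intervalIntegral.integral_interval_add_Ioi (a := (0 : ℝ)) (b := a)
    hf.integrableOn hf.integrableOn
  rw [← integral_Iic_eq_integral_Iio, hneg]
  linarith

/-- A rotation moving a given vector to a coordinate axis. -/
theorem Matrix.exists_transpose_mul_self_eq_one_mulVec_eq_single {ι : Type*} [Fintype ι]
    [DecidableEq ι] (w : ι → ℝ) (i₀ : ι) :
    ∃ U : Matrix ι ι ℝ, Uᵀ * U = 1 ∧ U *ᵥ w = Pi.single i₀ √(w ⬝ᵥ w) := by
  rcases eq_or_ne w 0 with rfl | hw
  · exact ⟨1, by simp⟩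
  set v : EuclideanSpace ℝ ι := WithLp.toLp 2 w with hv
  have hv0 : v ≠ 0 := fun h => hw (by simpa [hv] using h)
  have hnorm : √(w ⬝ᵥ w) = ‖v‖ := by
    rw [EuclideanSpace.norm_eq]
    simp [hv, dotProduct, sq]
  have horth : Orthonormal ℝ (({i₀} : Set ι).domRestrict fun _ => ‖v‖⁻¹ • v) := by
    refine ⟨fun i => ?_, fun i j hij => (hij (Subsingleton.elim i j)).elim⟩
    simp [norm_smul, hv0]
  obtain ⟨b, hb⟩ := horth.exists_orthonormalBasis_extension_of_card_eq finrank_euclideanSpace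
  have hbv : v = ‖v‖ • b i₀ := by
    rw [hb i₀ rfl, smul_inv_smul₀ (norm_ne_zero_iff.2 hv0)]
  have hinner : ∀ (x y : EuclideanSpace ℝ ι), ∑ j, x j * y j = inner ℝ x y := fun x y => by
    simp [PiLp.inner_apply, mul_comm]
  refine ⟨Matrix.of fun i j => b i j, mul_eq_one_comm.1 ?_, ?_⟩
  · ext i k
    simp only [mul_apply, transpose_apply, of_apply, hinner, one_apply]
    exact orthonormal_iff_ite.1 b.orthonormal i k
  · ext i
    have : (Matrix.of (fun i j => b i j) *ᵥ w) i = inner ℝ (b i) v := hinner (b i) v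
    rw [this, hnorm, Pi.single_apply, hbv, inner_smul_right,
      orthonormal_iff_ite.1 b.orthonormal i i₀, ← hbv]
    simp

open scoped MatrixOrder in
/-- A square root of a positive semidefinite matrix moving a given vector to a coordinate axis. -/
theorem Matrix.PosSemidef.exists_transpose_mul_self_mulVec_eq_single {ι : Type*} [Fintype ι]
    [DecidableEq ι] {S : Matrix ι ι ℝ} (hS : S.PosSemidef) (e : ι → ℝ) (i₀ : ι) :
    ∃ M : Matrix ι ι ℝ, Mᵀ * M = S ∧ M *ᵥ e = Pi.single i₀ √(e ⬝ᵥ (S *ᵥ e)) := by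
  obtain ⟨B, rfl⟩ := CStarAlgebra.nonneg_iff_eq_star_mul_self.mp hS.nonneg
  obtain ⟨U, hU, hUw⟩ := Matrix.exists_transpose_mul_self_eq_one_mulVec_eq_single (B *ᵥ e) i₀
  have hB : star B = Bᵀ := by rw [star_eq_conjTranspose, conjTranspose_eq_transpose_of_trivial]
  refine ⟨U * B, ?_, ?_⟩
  · rw [transpose_mul, Matrix.mul_assoc, ← Matrix.mul_assoc Uᵀ, hU, Matrix.one_mul, hB]
  · rw [← mulVec_mulVec, hUw, hB, ← mulVec_mulVec, dotProduct_mulVec e, vecMul_transpose]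

theorem setLIntegral_comp_mulVec {ι : Type*} [Fintype ι] [DecidableEq ι] {M : Matrix ι ι ℝ}
    (hM : M.det ≠ 0) {f : (ι → ℝ) → ENNReal} (hf : Measurable f) {s : Set (ι → ℝ)}
    (hs : MeasurableSet s) :
    ∫⁻ x in {x | M *ᵥ x ∈ s}, f (M *ᵥ x) = ENNReal.ofReal |M.det|⁻¹ * ∫⁻ y in s, f y := by
  have hmeas : Measurable (toLin' M) := (toLin' M).continuous_of_finiteDimensional.measurable
  have := setLIntegral_map (μ := volume) hs hf hmeas
  rw [map_matrix_volume_pi_eq_smul_volume_pi hM, Measure.restrict_smul, lintegral_smul_measure,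
    abs_inv, smul_eq_mul] at this
  exact this.symm

/-- Corollary 3: for the pure bursty impulsive noise (GS model with ρ = 0), i.e. the
multivariate Student-t density `h(n) = k₂(1 + nᵀΣ⁻¹n/α)^{−(α+p)/2}`, the exact BPSK ML
error probability is
`∫_{h(n+2A·e_p) > h(n)} h(n) dn = 1/2 − c_α ∫₀^{A√(e_pᵀΣ⁻¹e_p)} (1+t²/α)^{−(α+1)/2} dt`. -/
theorem exact_BER_pure_impulsive (p : ℕ) (hp : 2 ≤ p) (α A : ℝ)
    (hα : 0 < α) (hA : 0 < A)
    (Cov : Matrix (Fin p) (Fin p) ℝ) (hCov : Cov.PosDef)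
    (h : (Fin p → ℝ) → ℝ)
    (hh : ∀ n, h n =
        (Real.Gamma ((α + p) / 2) /
            (Real.Gamma (α / 2) * (α * π) ^ ((p : ℝ) / 2) * Real.sqrt Cov.det)) *
          (1 + (n ⬝ᵥ (Cov⁻¹ *ᵥ n)) / α) ^ (-(α + (p : ℝ)) / 2)) :
    (∫ n in {n : Fin p → ℝ | h (n + fun _ => 2 * A) > h n}, h n)
      = 1 / 2 - (Real.Gamma ((α + 1) / 2) / (Real.Gamma (α / 2) * Real.sqrt (α * π))) *
          ∫ t in (0 : ℝ)..(A * Real.sqrt ((fun _ => (1 : ℝ)) ⬝ᵥ (Cov⁻¹ *ᵥ (fun _ => (1 : ℝ))))),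
            (1 + t ^ 2 / α) ^ (-(α + 1) / 2) := by
  have hp0 : 0 < p := by omega
  let i₀ : Fin p := ⟨0, hp0⟩
  obtain ⟨M, hMM, hMe⟩ :=
    hCov.inv.posSemidef.exists_transpose_mul_self_mulVec_eq_single (fun _ => (1 : ℝ)) i₀
  set r := √((fun _ => (1 : ℝ)) ⬝ᵥ (Cov⁻¹ *ᵥ (fun _ => (1 : ℝ)))) with hr
  have hr0 : 0 < r := by
    have := hCov.inv.dotProduct_mulVec_pos (x := fun _ => (1 : ℝ))
      (fun hc => one_ne_zero (congrFun hc i₀))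
    exact sqrt_pos.2 (by simpa using this)
  have hdet : 0 < Cov.det := hCov.det_pos
  have hMdet : |M.det|⁻¹ = √Cov.det := by
    have := congrArg Matrix.det hMM
    rw [det_mul, det_transpose, det_nonsing_inv, Ring.inverse_eq_inv'] at this
    rw [← _root_.inv_inj, inv_inv, ← sqrt_inv, ← this, sqrt_mul_self_eq_abs]
  have hMdet0 : M.det ≠ 0 := by
    rintro h0
    rw [h0, abs_zero, _root_.inv_zero] at hMdet
    exact (sqrt_pos.2 hdet).ne hMdet
  have hquad : ∀ n, n ⬝ᵥ (Cov⁻¹ *ᵥ n) = ∑ i, (M *ᵥ n) i ^ 2 := fun n => by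
    rw [← hMM, ← mulVec_mulVec, dotProduct_mulVec n, vecMul_transpose]
    simp [dotProduct, sq]
  have hquad0 : ∀ n, 0 ≤ n ⬝ᵥ (Cov⁻¹ *ᵥ n) := fun n => by
    rw [hquad]
    positivity
  have hquad_shift : ∀ n : Fin p → ℝ,
      (n + fun _ => 2 * A) ⬝ᵥ (Cov⁻¹ *ᵥ (n + fun _ => 2 * A)) =
        n ⬝ᵥ (Cov⁻¹ *ᵥ n) + 4 * A * r * ((M *ᵥ n) i₀ + A * r) := fun n => by
    have he : (fun _ : Fin p => 2 * A) = (2 * A) • fun _ => (1 : ℝ) := by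
      ext; simp
    rw [hquad, hquad, he, mulVec_add, mulVec_smul, hMe]
    simp only [Pi.add_apply, Pi.smul_apply, smul_eq_mul, add_sq, Finset.sum_add_distrib,
      Pi.single_apply]
    simp
    ring
  have hΓp : 0 < Gamma ((α + p) / 2) := Gamma_pos_of_pos (by positivity)
  have hΓ1 : 0 < Gamma ((α + 1) / 2) := Gamma_pos_of_pos (by positivity)
  have hΓ : 0 < Gamma (α / 2) := Gamma_pos_of_pos (by positivity)
  set k := Gamma ((α + p) / 2) / (Gamma (α / 2) * (α * π) ^ ((p : ℝ) / 2) * √Cov.det) with hk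
  have hk0 : 0 < k := by positivity
  have hregion : {n : Fin p → ℝ | h (n + fun _ => 2 * A) > h n} =
      {n | M *ᵥ n ∈ {y : Fin p → ℝ | y i₀ ∈ Set.Iio (-(A * r))}} := by
    ext n
    have h1 : 0 < 1 + (n ⬝ᵥ (Cov⁻¹ *ᵥ n)) / α := by have := hquad0 n; positivity
    have h2 : 0 < 1 + ((n + fun _ => 2 * A) ⬝ᵥ (Cov⁻¹ *ᵥ (n + fun _ => 2 * A))) / α := by
      have := hquad0 (n + fun _ => 2 * A); positivity
    have hexp : -(α + (p : ℝ)) / 2 < 0 := by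
      rw [neg_div, neg_lt_zero]; positivity
    simp only [Set.mem_ofPred_eq, Set.mem_Iio, gt_iff_lt, hh]
    rw [mul_lt_mul_iff_right₀ hk0, rpow_lt_rpow_iff_of_neg h1 h2 hexp, add_lt_add_iff_left,
      div_lt_div_iff_of_pos_right hα, hquad_shift, add_lt_iff_neg_left,
      ← neg_pos, ← mul_neg, mul_pos_iff_of_pos_left (by positivity)]
    constructor <;> intro <;> linarith
  have hS : MeasurableSet {y : Fin p → ℝ | y i₀ ∈ Set.Iio (-(A * r))} :=
    measurable_pi_apply i₀ measurableSet_Iio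
  set J := ∫ t in Set.Iio (-(A * r)), (1 + t ^ 2 / α) ^ (-(α + 1) / 2) with hJ
  have hJ0 : 0 ≤ J := integral_nonneg fun t => by positivity
  have hslab := Gamma_mul_lintegral_slab i₀ (T := Set.Iio (-(A * r))) measurableSet_Iio hα
  rw [Fintype.card_fin, ← ofReal_integral_eq_lintegral_ofReal
    (integrable_one_add_sq_div_rpow hα).integrableOn (.of_forall fun t => by positivity),
    ← hJ, ← ENNReal.ofReal_mul hΓ1.le, ← ENNReal.ofReal_mul (by positivity)] at hslab
  have hslab_real := congrArg ENNReal.toReal hslab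
  rw [ENNReal.toReal_mul, ENNReal.toReal_ofReal hΓp.le, ENNReal.toReal_ofReal (by positivity)]
    at hslab_real
  have hval : ∫ n in {n : Fin p → ℝ | h (n + fun _ => 2 * A) > h n}, h n =
      Gamma ((α + 1) / 2) / (Gamma (α / 2) * √(α * π)) * J := by
    rw [hregion]
    simp only [hh, hquad]
    rw [integral_const_mul, integral_eq_lintegral_of_nonneg_ae
      (.of_forall fun n => by positivity)
      (by unfold Matrix.mulVec dotProduct; fun_prop : Measurable _).aestronglyMeasurable,
      setLIntegral_comp_mulVec hMdet0
        (f := fun y => ENNReal.ofReal ((1 + (∑ i, y i ^ 2) / α) ^ (-(α + (p : ℝ)) / 2)))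
        (by fun_prop) hS,
      ENNReal.toReal_mul, hMdet, ENNReal.toReal_ofReal (sqrt_nonneg _)]
    have hpow : (α * π) ^ ((p : ℝ) / 2) = √(α * π) ^ (p - 1) * √(α * π) := by
      rw [← pow_succ, Nat.sub_add_cancel hp0, sqrt_eq_rpow, ← rpow_natCast,
        ← rpow_mul (by positivity)]
      congr 1
      ring
    rw [hk, hpow]
    have hdet' := sqrt_pos.2 hdet
    have hsq : 0 < √(α * π) := sqrt_pos.2 (by positivity)
    generalize ENNReal.toReal _ = I at hslab_real ⊢
    field_simp
    linear_combination hslab_real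
  have htotal := integral_one_add_sq_div_rpow hα
  rw [hval, hJ, setIntegral_Iio_neg_eq (integrable_one_add_sq_div_rpow hα) (fun t => by simp)]
  have hsq : 0 < √(α * π) := sqrt_pos.2 (by positivity)
  generalize ∫ t : ℝ, (1 + t ^ 2 / α) ^ (-(α + 1) / 2) = I at htotal ⊢
  generalize ∫ t in (0 : ℝ)..(A * r), (1 + t ^ 2 / α) ^ (-(α + 1) / 2) = K
  field_simp
  linear_combination htotal
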